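/- Let p ≥ 3 be an integer and let f = (f_{i,j}) be an infinite frieze pattern of type Λ_p. Then for every integer i, the set {j ∈ ℤ : j ≥ i+2 and f_{i,j} = 1} is finite, and the set {j ∈ ℤ : j ≤ i−2 and f_{j,i} = 1} is finite. -/

import Mathlib

/-- `lam p = λ_p = 2 cos (π / p)`. -/
noncomputable def lam (p : ℕ) : ℝ := 2 * Real.cos (Real.pi / p)

/-- An infinite frieze pattern. -/
def IsInfFrieze (f : ℤ → ℤ → ℝ) : Prop :=
  (∀ i : ℤ, f i i = 0) ∧
  (∀ i : ℤ, f i (i + 1) = 1) ∧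
  (∀ i j : ℤ, i + 1 ≤ j → 0 < f i j) ∧
  (∀ i j : ℤ, i + 1 ≤ j → f i j * f (i + 1) (j + 1) - f i (j + 1) * f (i + 1) j = 1)

/-- The frieze pattern is of type `Λ_p`. -/
def IsTypeLambda (p : ℕ) (f : ℤ → ℤ → ℝ) : Prop :=
  ∀ i : ℤ, ∃ n : ℕ, 0 < n ∧ f i (i + 2) = n * lam p

/-- normalized sines -/
noncomputable def sS (p : ℕ) (k : ℕ) : ℝ := Real.sin (k * (Real.pi / p)) / Real.sin (Real.pi / p)

lemma sin_pos_p (p : ℕ) (hp : 3 ≤ p) : 0 < Real.sin (Real.pi / p) := by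
  have h3 : (3:ℝ) ≤ p := by exact_mod_cast hp
  apply Real.sin_pos_of_pos_of_lt_pi
  · have := Real.pi_pos
    positivity
  · exact div_lt_self Real.pi_pos (by linarith)

lemma sS_zero (p : ℕ) : sS p 0 = 0 := by simp [sS]

lemma sS_one (p : ℕ) (hp : 3 ≤ p) : sS p 1 = 1 := by
  have := sin_pos_p p hp
  simp [sS, this.ne']

lemma sS_rec (p : ℕ) (k : ℕ) : sS p (k + 2) = lam p * sS p (k + 1) - sS p k := by
  unfold sS lam
  have h1 : ((k + 2 : ℕ) : ℝ) * (Real.pi / p) = ((k + 1 : ℕ) : ℝ) * (Real.pi / p) + Real.pi / p := by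
    push_cast; ring
  have h2 : ((k : ℕ) : ℝ) * (Real.pi / p) = ((k + 1 : ℕ) : ℝ) * (Real.pi / p) - Real.pi / p := by
    push_cast; ring
  rw [h1, h2, Real.sin_add, Real.sin_sub]
  ring

lemma sS_p (p : ℕ) (hp : 3 ≤ p) : sS p p = 0 := by
  have : (p : ℝ) ≠ 0 := by positivity
  unfold sS
  rw [mul_div_cancel₀ _ this]
  simp

lemma sS_ge (p : ℕ) (hp : 3 ≤ p) (k : ℕ) (h1 : 1 ≤ k) (h2 : k + 1 ≤ p) : 1 ≤ sS p k := by
  have hs := sin_pos_p p hp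
  unfold sS
  rw [one_le_div hs]
  have hp0 : (0 : ℝ) < p := by positivity
  have hd : 0 < Real.pi / p := by have := Real.pi_pos; positivity
  have hpp : (p : ℝ) * (Real.pi / p) = Real.pi := mul_div_cancel₀ _ hp0.ne'
  have h1' : (1 : ℝ) ≤ k := by exact_mod_cast h1
  have h2' : (k : ℝ) + 1 ≤ p := by exact_mod_cast h2
  set d := Real.pi / p with hdd
  rcases le_total ((k : ℝ) * d) (Real.pi / 2) with h | h
  · apply Real.sin_le_sin_of_le_of_le_pi_div_two
    · linarith [Real.pi_pos]
    · exact h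
    · nlinarith
  · rw [← Real.sin_pi_sub (k * d)]
    apply Real.sin_le_sin_of_le_of_le_pi_div_two
    · linarith [Real.pi_pos]
    · linarith
    · nlinarith

lemma sS_E (p : ℕ) (hp : 3 ≤ p) (k : ℕ) (h2 : k ≤ p) : sS p k = 0 ∨ 1 ≤ sS p k := by
  rcases Nat.eq_zero_or_pos k with rfl | h
  · left; exact sS_zero p
  rcases h2.eq_or_lt with rfl | h'
  · left; exact sS_p _ hp
  · right; exact sS_ge p hp k h h'

/-- Vectors reachable from a basis vector by the nonnegative generators. -/
inductive WW (p : ℕ) : ℝ → ℝ → Prop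
  | e1 : WW p 1 0
  | e2 : WW p 0 1
  | step (u v : ℝ) (k : ℕ) (h : WW p u v) (hk : k + 2 ≤ p) :
      WW p (u * sS p (k + 1) + v * sS p k) (u * sS p (k + 2) + v * sS p (k + 1))

lemma E_comb (a b c d : ℝ) (ha : a = 0 ∨ 1 ≤ a) (hb : b = 0 ∨ 1 ≤ b) (hc : c = 0 ∨ 1 ≤ c)
    (hd : d = 0 ∨ 1 ≤ d) : a * b + c * d = 0 ∨ 1 ≤ a * b + c * d := by
  have key : ∀ x y : ℝ, (x = 0 ∨ 1 ≤ x) → (y = 0 ∨ 1 ≤ y) → (x * y = 0 ∨ 1 ≤ x * y) := by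
    rintro x y (rfl | hx) (rfl | hy)
    · simp
    · simp
    · simp
    · right; nlinarith
  rcases key a b ha hb with h | h <;> rcases key c d hc hd with h' | h'
  · left; linarith
  · right; linarith
  · right; linarith
  · right; linarith

lemma WW_E (p : ℕ) (hp : 3 ≤ p) (u v : ℝ) (h : WW p u v) :
    (u = 0 ∨ 1 ≤ u) ∧ (v = 0 ∨ 1 ≤ v) := by
  induction h with
  | e1 => simp
  | e2 => simp
  | step u v k h hk ih =>
    exact ⟨E_comb _ _ _ _ ih.1 (sS_E p hp _ (by omega)) ih.2 (sS_E p hp _ (by omega)),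
      E_comb _ _ _ _ ih.1 (sS_E p hp _ (by omega)) ih.2 (sS_E p hp _ (by omega))⟩

/-- Signed, rotated reachable vectors. -/
def RR (p : ℕ) (x y : ℝ) : Prop :=
  ∃ u v, WW p u v ∧ ((x = u ∧ y = v) ∨ (x = -u ∧ y = -v) ∨ (x = v ∧ y = -u) ∨ (x = -v ∧ y = u))

lemma RR_S (p : ℕ) (x y : ℝ) (h : RR p x y) : RR p y (-x) := by
  obtain ⟨u, v, hw, h⟩ := h
  refine ⟨u, v, hw, ?_⟩
  rcases h with ⟨rfl, rfl⟩ | ⟨rfl, rfl⟩ | ⟨rfl, rfl⟩ | ⟨rfl, rfl⟩ <;> simp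

lemma RR_neg (p : ℕ) (x y : ℝ) (h : RR p x y) : RR p (-x) (-y) :=
  RR_S p _ _ (RR_S p _ _ h)

lemma sS_two (p : ℕ) (hp : 3 ≤ p) : sS p 2 = lam p := by
  have := sS_rec p 0
  simp only [zero_add] at this
  rw [this, sS_zero, sS_one p hp]; ring

lemma WW_T (p : ℕ) (hp : 3 ≤ p) (u v : ℝ) (h : WW p u v) : WW p u (lam p * u + v) := by
  have := WW.step u v 0 h (by omega)
  simp only [zero_add] at this
  rw [sS_zero, sS_one p hp, sS_two p hp] at this
  convert this using 1 <;> ring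

lemma RR_ST (p : ℕ) (hp : 3 ≤ p) (u v : ℝ) (h : WW p u v) : RR p v (lam p * v - u) := by
  cases h with
  | e1 => exact ⟨0, 1, WW.e2, by norm_num⟩
  | e2 => exact ⟨1, lam p * 1 + 0, WW_T p hp _ _ WW.e1, by norm_num⟩
  | step u v k h hk =>
    have e1 := sS_rec p k
    have e2 := sS_rec p (k + 1)
    rcases hk.eq_or_lt with h' | h'
    · have e3 : sS p (k + 2) = 0 := by rw [h']; exact sS_p p hp
      have e4 : sS p (k + 1) = 1 := by
        have hs := sin_pos_p p hp
        have hp0 : (p : ℝ) ≠ 0 := by positivity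
        unfold sS
        have : ((k + 1 : ℕ) : ℝ) * (Real.pi / p) = Real.pi - Real.pi / p := by
          have : ((k + 1 : ℕ) : ℝ) = p - 1 := by rw [← h']; push_cast; ring
          rw [this]; field_simp
        rw [this, Real.sin_pi_sub, div_self hs.ne']
      refine ⟨u, v, h, Or.inr (Or.inr (Or.inl ⟨?_, ?_⟩))⟩
      · rw [e3, e4]; ring
      · rw [e3, e4] at e1; rw [e3, e4]
        linear_combination -v * e1
    · refine ⟨_, _, WW.step u v (k + 1) h (by omega), Or.inl ⟨rfl, ?_⟩⟩
      linear_combination (-u) * e2 - v * e1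

lemma RR_T (p : ℕ) (hp : 3 ≤ p) (x y : ℝ) (h : RR p x y) : RR p x (lam p * x + y) := by
  obtain ⟨u, v, hw, h⟩ := h
  rcases h with ⟨rfl, rfl⟩ | ⟨rfl, rfl⟩ | ⟨rfl, rfl⟩ | ⟨rfl, rfl⟩
  · exact ⟨_, _, WW_T p hp _ _ hw, by simp⟩
  · exact ⟨_, _, WW_T p hp _ _ hw, Or.inr (Or.inl ⟨rfl, by ring⟩)⟩
  · exact RR_ST p hp _ _ hw
  · have := RR_neg p _ _ (RR_ST p hp _ _ hw)
    convert this using 1; ring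

lemma RR_Tn (p : ℕ) (hp : 3 ≤ p) (x y : ℝ) (h : RR p x y) (n : ℕ) :
    RR p x (n * lam p * x + y) := by
  induction n with
  | zero => simpa using h
  | succ n ih =>
    have := RR_T p hp _ _ ih
    convert this using 1; push_cast; ring

lemma frieze_rec (f : ℤ → ℤ → ℝ) (hf : IsInfFrieze f) (n : ℕ) : ∀ j : ℤ,
    f j (j + n + 2) = f (j + n) (j + n + 2) * f j (j + n + 1) - f j (j + n) := by
  obtain ⟨h0, h1, hpos, hu⟩ := hf
  induction n with
  | zero => intro j; simp [h0, h1]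
  | succ n ih =>
    intro j
    have i1 := ih (j + 1)
    have a := hu j (j + n + 1) (by omega)
    have b := hu j (j + n + 2) (by omega)
    have c := hpos (j + 1) (j + n + 2) (by omega)
    push_cast
    rw [show j + 1 + (n:ℤ) + 2 = j + n + 3 by ring, show j + 1 + (n:ℤ) + 1 = j + n + 2 by ring,
      show j + 1 + (n:ℤ) = j + n + 1 by ring] at i1
    rw [show j + (n:ℤ) + 1 + 1 = j + n + 2 by ring] at a
    rw [show j + (n:ℤ) + 2 + 1 = j + n + 3 by ring] at b
    rw [show j + ((n:ℤ) + 1) + 2 = j + n + 3 by ring, show j + ((n:ℤ) + 1) + 1 = j + n + 2 by ring,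
      show j + ((n:ℤ) + 1) = j + n + 1 by ring]
    apply mul_right_cancel₀ c.ne'
    linear_combination f j (j + n + 2) * i1 + a - b

lemma frieze_rec' (f : ℤ → ℤ → ℝ) (hf : IsInfFrieze f) (j k : ℤ) (h : j ≤ k) :
    f j (k + 2) = f k (k + 2) * f j (k + 1) - f j k := by
  obtain ⟨n, rfl⟩ := Int.le.dest h
  exact frieze_rec f hf n j

lemma frieze_RR (p : ℕ) (hp : 3 ≤ p) (f : ℤ → ℤ → ℝ) (hf : IsInfFrieze f)
    (hl : IsTypeLambda p f) (j : ℤ) (n : ℕ) : RR p (f j (j + n + 1)) (-f j (j + n)) := by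
  induction n with
  | zero =>
    simp only [Nat.cast_zero, add_zero, hf.1, hf.2.1]
    exact ⟨1, 0, WW.e1, by simp⟩
  | succ n ih =>
    obtain ⟨m, -, hm⟩ := hl (j + n)
    have := RR_S p _ _ (RR_Tn p hp _ _ ih m)
    rw [← hm, ← sub_eq_add_neg, ← frieze_rec f hf n j] at this
    push_cast
    convert this using 2 <;> ring_nf

lemma frieze_ge_one (p : ℕ) (hp : 3 ≤ p) (f : ℤ → ℤ → ℝ) (hf : IsInfFrieze f)
    (hl : IsTypeLambda p f) (j k : ℤ) (h : j + 1 ≤ k) : 1 ≤ f j k := by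
  obtain ⟨n, rfl⟩ := Int.le.dest h
  have hpos := hf.2.2.1 _ _ h
  rw [show j + 1 + (n:ℤ) = j + n + 1 by ring] at *
  obtain ⟨u, v, hw, h⟩ := frieze_RR p hp f hf hl j n
  obtain ⟨hu, hv⟩ := WW_E p hp u v hw
  rcases h with h | h | h | h <;> rcases hu with hu | hu <;> rcases hv with hv | hv <;>
    linarith [h.1]

lemma frieze_ptolemy (f : ℤ → ℤ → ℝ) (hf : IsInfFrieze f) (i j : ℤ) (hij : i + 1 ≤ j) (n : ℕ) :
    f i j * f (i + 1) (j + n) - f i (j + n) * f (i + 1) j = f j (j + n) ∧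
    f i j * f (i + 1) (j + n + 1) - f i (j + n + 1) * f (i + 1) j = f j (j + n + 1) := by
  induction n with
  | zero =>
    simp only [Nat.cast_zero, add_zero, hf.1 j, hf.2.1 j]
    exact ⟨by ring, hf.2.2.2 i j hij⟩
  | succ n ih =>
    push_cast
    rw [show j + ((n:ℤ) + 1) + 1 = j + n + 2 by ring, show j + ((n:ℤ) + 1) = j + n + 1 by ring]
    refine ⟨ih.2, ?_⟩
    rw [frieze_rec' f hf i (j + n) (by omega), frieze_rec' f hf (i + 1) (j + n) (by omega),
      frieze_rec f hf n j]
    linear_combination f (j + n) (j + n + 2) * ih.2 - ih.1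

lemma frieze_half (p : ℕ) (hp : 3 ≤ p) (f : ℤ → ℤ → ℝ)
    (hf : IsInfFrieze f) (hl : IsTypeLambda p f) (i : ℤ) :
    ({j : ℤ | i + 2 ≤ j ∧ f i j = 1}).Finite := by
  have key : ∀ j k : ℤ, i + 1 ≤ j → j < k → f i j = 1 → f i k = 1 →
      f (i - 1) k + 1 ≤ f (i - 1) j := by
    intro j k hij hjk h1 h2
    have h3 := frieze_ge_one p hp f hf hl j k (by omega)
    obtain ⟨n, rfl⟩ := Int.le.dest hjk.le
    have := (frieze_ptolemy f hf (i - 1) j (by omega) n).1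
    rw [sub_add_cancel, h1, h2] at this
    linarith
  apply Set.Finite.of_finite_image (f := fun j => ⌊f (i - 1) j⌋₊)
  · apply (Set.finite_Iic ⌊f (i - 1) (i + 1)⌋₊).subset
    rintro _ ⟨j, ⟨h1, h2⟩, rfl⟩
    apply Nat.floor_le_floor
    linarith [key (i + 1) j le_rfl (by omega) (hf.2.1 i) h2]
  · have aux : ∀ j k : ℤ, i + 2 ≤ j → j < k → f i j = 1 → f i k = 1 →
        ⌊f (i - 1) j⌋₊ ≠ ⌊f (i - 1) k⌋₊ := by
      intro j k hij hjk h1 h2 he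
      have h3 := key j k (by omega) hjk h1 h2
      have h4 := hf.2.2.1 (i - 1) k (by omega)
      have h5 := Nat.floor_le_floor h3
      rw [Nat.floor_add_one h4.le] at h5
      omega
    rintro j ⟨hj, hj1⟩ k ⟨hk, hk1⟩ he
    rcases lt_trichotomy j k with h | h | h
    · exact absurd he (aux j k hj h hj1 hk1)
    · exact h
    · exact absurd he.symm (aux k j hk h hk1 hj1)

/-- Local finiteness: each vertex meets only finitely many arcs. -/
theorem infFrieze_locally_finite (p : ℕ) (hp : 3 ≤ p) (f : ℤ → ℤ → ℝ)
    (hf : IsInfFrieze f) (hl : IsTypeLambda p f) (i : ℤ) :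
    ({j : ℤ | i + 2 ≤ j ∧ f i j = 1}).Finite ∧
    ({j : ℤ | j ≤ i - 2 ∧ f j i = 1}).Finite := by
  refine ⟨frieze_half p hp f hf hl i, ?_⟩
  have hg : IsInfFrieze (fun a b => f (-b) (-a)) := by
    refine ⟨fun a => hf.1 _, fun a => ?_, fun a b h => hf.2.2.1 _ _ (by omega), fun a b h => ?_⟩
    · have := hf.2.1 (-(a + 1))
      rwa [show -(a + 1) + 1 = -a by ring] at this
    · have := hf.2.2.2 (-(b + 1)) (-(a + 1)) (by omega)
      rw [show -(a + 1) + 1 = -a by ring, show -(b + 1) + 1 = -b by ring] at this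
      linarith
  have hgl : IsTypeLambda p (fun a b => f (-b) (-a)) := by
    intro a
    have := hl (-(a + 2))
    rwa [show -(a + 2) + 2 = -a by ring] at this
  have := (frieze_half p hp _ hg hgl (-i)).image (fun x => -x)
  apply this.subset
  rintro j ⟨h1, h2⟩
  refine ⟨-j, ⟨by omega, ?_⟩, by simp⟩
  simpa using h2
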